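/- Let R be a semiring with R ≠ {0} such that sums and products of nonzero elements are nonzero. There is a bijection between partial congruences 𝒞 on R ×ₑ 𝕋 and congruences 𝒞' on R satisfying f ≁ 0 for all f ∈ R \ {0}, given by Φ(𝒞) = {(f,g) : ((f,0),(g,0)) ∈ 𝒞} ∪ {(0,0)} and Ψ(𝒞') = {((f,a),(g,a)) : (f,g) ∈ 𝒞', a ∈ ℝ} ∪ {(-∞,-∞)}, and these maps are mutually inverse. -/

import Mathlib

/-- The 𝕋-extension `R ×ₑ 𝕋` of a semiring-like structure with zero `zero`:
carrier `((R \ {zero}) × ℝ) ∪ {-∞}`, with `none` playing the role of `-∞`. -/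
abbrev TExt (R : Type*) (zero : R) : Type _ := Option ({f : R // f ≠ zero} × ℝ)

/-- Addition on the 𝕋-extension. -/
noncomputable def TExt.add {R : Type*} {zero : R} (radd : R → R → R)
    (h : ∀ f g : R, f ≠ zero → g ≠ zero → radd f g ≠ zero) :
    TExt R zero → TExt R zero → TExt R zero
  | none, x => x
  | x, none => x
  | some (f, a), some (g, b) =>
      if a > b then some (f, a)
      else if a < b then some (g, b)
      else some (⟨radd f.1 g.1, h _ _ f.2 g.2⟩, a)

/-- Multiplication on the 𝕋-extension. -/
def TExt.mul {R : Type*} {zero : R} (rmul : R → R → R)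
    (h : ∀ f g : R, f ≠ zero → g ≠ zero → rmul f g ≠ zero) :
    TExt R zero → TExt R zero → TExt R zero
  | none, _ => none
  | _, none => none
  | some (f, a), some (g, b) => some (⟨rmul f.1 g.1, h _ _ f.2 g.2⟩, a + b)

/-- A congruence on the 𝕋-extension: an equivalence relation compatible with
both operations. -/
noncomputable def TExt.IsCongruence {R : Type*} {zero : R} (radd rmul : R → R → R)
    (hadd : ∀ f g : R, f ≠ zero → g ≠ zero → radd f g ≠ zero)
    (hmul : ∀ f g : R, f ≠ zero → g ≠ zero → rmul f g ≠ zero)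
    (C : TExt R zero → TExt R zero → Prop) : Prop :=
  Equivalence C ∧
    (∀ a b c d, C a b → C c d → C (TExt.add radd hadd a c) (TExt.add radd hadd b d)) ∧
    (∀ a b c d, C a b → C c d → C (TExt.mul rmul hmul a c) (TExt.mul rmul hmul b d))

/-- A congruence on the semiring `R`. -/
def RCong {R : Type*} [Semiring R] (C' : R → R → Prop) : Prop :=
  Equivalence C' ∧ (∀ a b c d, C' a b → C' c d → C' (a + c) (b + d)) ∧
    (∀ a b c d, C' a b → C' c d → C' (a * c) (b * d))

/-- `Φ(𝒞) = {(f,g) : ((f,0),(g,0)) ∈ 𝒞} ∪ {(0,0)}`. -/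
def PhiRel {R : Type*} [Semiring R] (C : TExt R (0 : R) → TExt R (0 : R) → Prop)
    (f g : R) : Prop :=
  (∃ (hf : f ≠ 0) (hg : g ≠ 0), C (some (⟨f, hf⟩, (0 : ℝ))) (some (⟨g, hg⟩, (0 : ℝ)))) ∨
    (f = 0 ∧ g = 0)

/-- `Ψ(𝒞') = {((f,a),(g,a)) : (f,g) ∈ 𝒞', a ∈ ℝ} ∪ {(-∞,-∞)}`. -/
def PsiRel {R : Type*} [Semiring R] (C' : R → R → Prop)
    (x y : TExt R (0 : R)) : Prop :=
  (x = none ∧ y = none) ∨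
    ∃ (f g : {x : R // x ≠ 0}) (a : ℝ), C' f.1 g.1 ∧ x = some (f, a) ∧ y = some (g, a)

section Helpers

variable {R : Type*} [Semiring R]
  {hadd : ∀ f g : R, f ≠ 0 → g ≠ 0 → f + g ≠ 0}
  {hmul : ∀ f g : R, f ≠ 0 → g ≠ 0 → f * g ≠ 0}

/-- A congruence on the 𝕋-extension is invariant under translating the tropical coordinate. -/
theorem TExt.IsCongruence.translate [Nontrivial R] {C : TExt R (0 : R) → TExt R (0 : R) → Prop}
    (hC : TExt.IsCongruence (· + ·) (· * ·) hadd hmul C) {f g : {x : R // x ≠ 0}} {a b : ℝ}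
    (h : C (some (f, a)) (some (g, b))) (c : ℝ) :
    C (some (f, a + c)) (some (g, b + c)) := by
  simpa [TExt.mul] using hC.2.2 _ _ _ _ h (hC.1.refl (some (⟨1, one_ne_zero⟩, c)))

/-- A partial congruence does not identify any element with `-∞`. -/
theorem TExt.IsCongruence.not_some_none [Nontrivial R]
    {C : TExt R (0 : R) → TExt R (0 : R) → Prop}
    (hC : TExt.IsCongruence (· + ·) (· * ·) hadd hmul C)
    (hp : ∀ (f g : {x : R // x ≠ 0}) (a b : ℝ), C (some (f, a)) (some (g, b)) → a = b)
    (f : {x : R // x ≠ 0}) (a : ℝ) : ¬ C (some (f, a)) none := by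
  intro h
  have h' : C (some (f, a + 1)) none := by
    simpa [TExt.mul] using
      hC.2.2 _ _ _ _ h (hC.1.refl (some ((⟨1, one_ne_zero⟩ : {x : R // x ≠ 0}), (1 : ℝ))))
  linarith [hp f f _ _ (hC.1.trans h (hC.1.symm h'))]

theorem TExt.IsCongruence.rCong_phiRel {C : TExt R (0 : R) → TExt R (0 : R) → Prop}
    (hC : TExt.IsCongruence (· + ·) (· * ·) hadd hmul C) : RCong (PhiRel C) := by
  refine ⟨⟨?_, ?_, ?_⟩, ?_, ?_⟩
  · intro f
    by_cases hf : f = 0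
    · exact .inr ⟨hf, hf⟩
    · exact .inl ⟨hf, hf, hC.1.refl _⟩
  · rintro f g (⟨hf, hg, h⟩ | ⟨hf, hg⟩)
    · exact .inl ⟨hg, hf, hC.1.symm h⟩
    · exact .inr ⟨hg, hf⟩
  · rintro f g k (⟨hf, hg, h⟩ | ⟨hf, hg⟩) (⟨hg', hk, h'⟩ | ⟨hg', hk⟩)
    · exact .inl ⟨hf, hk, hC.1.trans h h'⟩
    · exact absurd hg' hg
    · exact absurd hg hg'
    · exact .inr ⟨hf, hk⟩
  · rintro f g k l (⟨hf, hg, h⟩ | ⟨rfl, rfl⟩) (⟨hk, hl, h'⟩ | ⟨rfl, rfl⟩)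
    · exact .inl ⟨hadd _ _ hf hk, hadd _ _ hg hl, by
        simpa [TExt.add] using hC.2.1 _ _ _ _ h h'⟩
    · rw [add_zero, add_zero]
      exact .inl ⟨hf, hg, h⟩
    · rw [zero_add, zero_add]
      exact .inl ⟨hk, hl, h'⟩
    · exact .inr ⟨add_zero 0, add_zero 0⟩
  · rintro f g k l (⟨hf, hg, h⟩ | ⟨rfl, rfl⟩) (⟨hk, hl, h'⟩ | ⟨rfl, rfl⟩)
    · exact .inl ⟨hmul _ _ hf hk, hmul _ _ hg hl, by
        simpa [TExt.mul] using hC.2.2 _ _ _ _ h h'⟩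
    all_goals exact .inr ⟨by simp, by simp⟩

theorem TExt.IsCongruence.psiRel_phiRel [Nontrivial R]
    {C : TExt R (0 : R) → TExt R (0 : R) → Prop}
    (hC : TExt.IsCongruence (· + ·) (· * ·) hadd hmul C)
    (hp : ∀ (f g : {x : R // x ≠ 0}) (a b : ℝ), C (some (f, a)) (some (g, b)) → a = b)
    (x y : TExt R (0 : R)) : PsiRel (PhiRel C) x y ↔ C x y := by
  constructor
  · rintro (⟨rfl, rfl⟩ | ⟨f, g, a, ⟨hf, hg, h⟩ | ⟨hf, hg⟩, rfl, rfl⟩)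
    · exact hC.1.refl _
    · simpa using hC.translate h a
    · exact absurd hf f.2
  · intro h
    rcases x with _ | ⟨f, a⟩ <;> rcases y with _ | ⟨g, b⟩
    · exact .inl ⟨rfl, rfl⟩
    · exact absurd (hC.1.symm h) (hC.not_some_none hp g b)
    · exact absurd h (hC.not_some_none hp f a)
    · obtain rfl := hp f g a b h
      exact .inr ⟨f, g, a, .inl ⟨f.2, g.2, by simpa using hC.translate h (-a)⟩, rfl, rfl⟩

theorem psiRel_some_some {C' : R → R → Prop} {f g : {x : R // x ≠ 0}} {a b : ℝ} :
    PsiRel C' (some (f, a)) (some (g, b)) ↔ C' f.1 g.1 ∧ a = b := by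
  constructor
  · rintro (⟨h, -⟩ | ⟨f', g', c, h, hx, hy⟩)
    · cases h
    · cases hx
      cases hy
      exact ⟨h, rfl⟩
  · rintro ⟨h, rfl⟩
    exact .inr ⟨f, g, a, h, rfl, rfl⟩

theorem RCong.isCongruence_psiRel {C' : R → R → Prop} (hC : RCong C') :
    TExt.IsCongruence (· + ·) (· * ·) hadd hmul (PsiRel C') := by
  refine ⟨⟨?_, ?_, ?_⟩, ?_, ?_⟩
  · rintro (_ | ⟨f, a⟩)
    · exact .inl ⟨rfl, rfl⟩
    · exact psiRel_some_some.2 ⟨hC.1.refl _, rfl⟩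
  · rintro x y (⟨rfl, rfl⟩ | ⟨f, g, a, h, rfl, rfl⟩)
    · exact .inl ⟨rfl, rfl⟩
    · exact psiRel_some_some.2 ⟨hC.1.symm h, rfl⟩
  · rintro x y (_ | ⟨k, b⟩) (⟨rfl, rfl⟩ | ⟨f, g, a, h, rfl, rfl⟩) h'
    · exact h'
    · rcases h' with ⟨h', -⟩ | ⟨_, _, _, _, _, h'⟩ <;> cases h'
    · exact h'
    · obtain ⟨hgk, rfl⟩ := psiRel_some_some.1 h'
      exact psiRel_some_some.2 ⟨hC.1.trans h hgk, rfl⟩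
  · rintro x y z w (⟨rfl, rfl⟩ | ⟨f, g, a, h, rfl, rfl⟩) (⟨rfl, rfl⟩ | ⟨k, l, b, h', rfl, rfl⟩)
    · exact .inl ⟨rfl, rfl⟩
    · exact psiRel_some_some.2 ⟨h', rfl⟩
    · exact psiRel_some_some.2 ⟨h, rfl⟩
    · simp only [TExt.add]
      split_ifs
      · exact psiRel_some_some.2 ⟨h, rfl⟩
      · exact psiRel_some_some.2 ⟨h', rfl⟩
      · exact psiRel_some_some.2 ⟨hC.2.1 _ _ _ _ h h', rfl⟩
  · rintro x y z w (⟨rfl, rfl⟩ | ⟨f, g, a, h, rfl, rfl⟩) (⟨rfl, rfl⟩ | ⟨k, l, b, h', rfl, rfl⟩)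
    · exact .inl ⟨rfl, rfl⟩
    · exact .inl ⟨rfl, rfl⟩
    · exact .inl ⟨rfl, rfl⟩
    · exact psiRel_some_some.2 ⟨hC.2.2 _ _ _ _ h h', rfl⟩

theorem RCong.phiRel_psiRel {C' : R → R → Prop} (hC : RCong C')
    (h0 : ∀ f : R, f ≠ 0 → ¬ C' f 0) (f g : R) : PhiRel (PsiRel C') f g ↔ C' f g := by
  constructor
  · rintro (⟨hf, hg, h⟩ | ⟨rfl, rfl⟩)
    · exact (psiRel_some_some.1 h).1
    · exact hC.1.refl _
  · intro h
    by_cases hf : f = 0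
    · subst hf
      exact .inr ⟨rfl, by_contra fun hg => h0 g hg (hC.1.symm h)⟩
    · by_cases hg : g = 0
      · subst hg
        exact absurd h (h0 f hf)
      · exact .inl ⟨hf, hg, psiRel_some_some.2 ⟨h, rfl⟩⟩

end Helpers

/-- `Φ` and `Ψ` give a mutually inverse bijection between
partial congruences on `R ×ₑ 𝕋` and congruences on `R` with `f ≁ 0` for all
`f ≠ 0`. -/
theorem TExt_partialCongruence_bijection {R : Type*} [Semiring R] [Nontrivial R]
    (hadd : ∀ f g : R, f ≠ 0 → g ≠ 0 → f + g ≠ 0)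
    (hmul : ∀ f g : R, f ≠ 0 → g ≠ 0 → f * g ≠ 0) :
    (∀ C : TExt R (0 : R) → TExt R (0 : R) → Prop,
      TExt.IsCongruence (· + ·) (· * ·) hadd hmul C →
      (∀ (f g : {x : R // x ≠ 0}) (a b : ℝ), C (some (f, a)) (some (g, b)) → a = b) →
      RCong (PhiRel C) ∧ (∀ f : R, f ≠ 0 → ¬ PhiRel C f 0) ∧
        (∀ x y, PsiRel (PhiRel C) x y ↔ C x y)) ∧
    (∀ C' : R → R → Prop, RCong C' → (∀ f : R, f ≠ 0 → ¬ C' f 0) →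
      TExt.IsCongruence (· + ·) (· * ·) hadd hmul (PsiRel C') ∧
      (∀ (f g : {x : R // x ≠ 0}) (a b : ℝ),
        PsiRel C' (some (f, a)) (some (g, b)) → a = b) ∧
      (∀ f g : R, PhiRel (PsiRel C') f g ↔ C' f g)) := by
  refine ⟨fun C hC hp => ⟨hC.rCong_phiRel, ?_, hC.psiRel_phiRel hp⟩,
    fun C' hC h0 => ⟨hC.isCongruence_psiRel, fun f g a b h => (psiRel_some_some.1 h).2,
      hC.phiRel_psiRel h0⟩⟩
  rintro f hf (⟨-, h, -⟩ | ⟨h, -⟩)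
  · exact h rfl
  · exact hf h
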